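/- arXiv:1704.06090 — 5 statements merged into one kernel-verified Lean document; each statement's English description precedes it below -/
import Mathlib

section
/- Let d ≥ 1 be an integer, T > 0, γ > 1 a real number, and G₀, P_M > 0. Suppose ρ : [0,T] × ℝ^d → ℝ is C¹ and nonnegative, and there exists R > 0 such that ρ(t,x) = 0 whenever |x| ≥ R, for all t ∈ [0,T]; suppose u : [0,T] × ℝ^d → ℝ^d is C¹; and suppose that the continuity equation with growth, ∂ₜρ + div(ρu) = ρ·G₀(P_M − ρ^γ), holds pointwise on [0,T] × ℝ^d. Then for every t ∈ [0,T], ∫_{ℝ^d} ρ(t,x) dx ≤ e^{G₀ P_M t} ∫_{ℝ^d} ρ(0,x) dx. -/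
open MeasureTheory Real

/-- The integral of a directional derivative of a compactly supported `C¹` function vanishes. -/
lemma integral_fderiv_eq_zero_of_hasCompactSupport {E : Type*} [NormedAddCommGroup E]
    [NormedSpace ℝ E] [FiniteDimensional ℝ E] [MeasurableSpace E] [BorelSpace E]
    {μ : Measure E} [μ.IsAddHaarMeasure] {f : E → ℝ} (hf : ContDiff ℝ 1 f)
    (hs : HasCompactSupport f) (v : E) : ∫ x, fderiv ℝ f x v ∂μ = 0 := by
  have hc : Continuous fun x => fderiv ℝ f x v :=
    (hf.continuous_fderiv one_ne_zero).clm_apply continuous_const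
  have hs' : HasCompactSupport fun x => fderiv ℝ f x v := hs.fderiv_apply ℝ v
  have h := integral_mul_fderiv_eq_neg_fderiv_mul_of_integrable (𝕜 := ℝ) (μ := μ) (v := v)
    (f := fun _ => (1 : ℝ)) (g := f) (by simp)
    (by simpa using hc.integrable_of_hasCompactSupport hs')
    (by simpa using hf.continuous.integrable_of_hasCompactSupport hs)
    (fun x _ => differentiableAt_const _) (fun x _ => hf.differentiable one_ne_zero x)
  simpa using h

/-- Differentiation under the integral over a compact set, for a jointly `C¹` integrand. -/
lemma hasDerivAt_setIntegral_of_contDiff {E : Type*} [NormedAddCommGroup E]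
    [NormedSpace ℝ E] [SecondCountableTopology E] [MeasurableSpace E] [BorelSpace E]
    {μ : Measure E} [IsFiniteMeasureOnCompacts μ] {f : ℝ → E → ℝ}
    (hf : ContDiff ℝ 1 fun p : ℝ × E => f p.1 p.2) {K : Set E} (hK : IsCompact K) (t : ℝ) :
    HasDerivAt (fun s => ∫ x in K, f s x ∂μ) (∫ x in K, deriv (fun s => f s x) t ∂μ) t := by
  have hd : ∀ s x, HasDerivAt (fun s => f s x)
      (fderiv ℝ (fun p : ℝ × E => f p.1 p.2) (s, x) (1, 0)) s := fun s x =>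
    HasFDerivAt.comp_hasDerivAt (l := fun p : ℝ × E => f p.1 p.2) (f := fun s => (s, x)) s
      (hf.differentiable one_ne_zero (s, x)).hasFDerivAt
      ((hasDerivAt_id s).prodMk (hasDerivAt_const s x))
  have hc : Continuous fun p : ℝ × E => fderiv ℝ (fun p : ℝ × E => f p.1 p.2) p (1, 0) :=
    (hf.continuous_fderiv one_ne_zero).clm_apply continuous_const
  have hcs : ∀ s, Continuous (f s) := fun s =>
    hf.continuous.comp (continuous_const.prodMk continuous_id)
  obtain ⟨C, hC⟩ := ((isCompact_Icc (a := t - 1) (b := t + 1)).prod hK).exists_bound_of_continuousOn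
    hc.continuousOn
  simp only [fun x => (hd t x).deriv]
  refine (hasDerivAt_integral_of_dominated_loc_of_deriv_le (bound := fun _ => C)
    (F' := fun s x => fderiv ℝ (fun p : ℝ × E => f p.1 p.2) (s, x) (1, 0))
    (Icc_mem_nhds (sub_one_lt t) (lt_add_one t))
    (Filter.Eventually.of_forall fun s => (hcs s).aestronglyMeasurable)
    ((hcs t).continuousOn.integrableOn_compact hK)
    (hc.comp (continuous_const.prodMk continuous_id)).aestronglyMeasurable ?_
    (continuousOn_const.integrableOn_compact hK)
    (Filter.Eventually.of_forall fun x s _ => hd s x)).2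
  filter_upwards [ae_restrict_mem hK.measurableSet] with x hx s hs
  exact hC (s, x) ⟨hs, hx⟩

/-- Grönwall's inequality in differential form on `[0, T]`. -/
lemma le_exp_mul_of_hasDerivAt_le {m m' : ℝ → ℝ} {K T : ℝ}
    (hm : ∀ t, HasDerivAt m (m' t) t) (hle : ∀ t ∈ Set.Icc 0 T, m' t ≤ K * m t) :
    ∀ t ∈ Set.Icc 0 T, m t ≤ exp (K * t) * m 0 := by
  have hd : ∀ t, HasDerivAt (fun t => exp (-K * t) * m t)
      (exp (-K * t) * (m' t - K * m t)) t := fun t => by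
    have h := (((hasDerivAt_id t).const_mul (-K)).exp).mul (hm t)
    refine h.congr_deriv ?_
    simp only [id]
    ring
  have hanti : AntitoneOn (fun t => exp (-K * t) * m t) (Set.Icc 0 T) := by
    refine antitoneOn_of_deriv_nonpos (convex_Icc 0 T)
      (fun t _ => (hd t).continuousAt.continuousWithinAt)
      (fun t _ => (hd t).differentiableAt.differentiableWithinAt) fun t ht => ?_
    rw [(hd t).deriv]
    exact mul_nonpos_of_nonneg_of_nonpos (exp_pos _).le
      (sub_nonpos.2 (hle t (interior_subset ht)))
  intro t ht
  have h := hanti (Set.left_mem_Icc.2 (ht.1.trans ht.2)) ht ht.1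
  simp only [mul_zero, exp_zero, one_mul] at h
  calc m t = exp (K * t) * (exp (-K * t) * m t) := by
        rw [← mul_assoc, ← exp_add]; simp
    _ ≤ exp (K * t) * m 0 := by gcongr

/-- A priori mass estimate: if `ρ ≥ 0` is `C¹`, compactly supported in space, `u` is `C¹`,
and `∂ₜρ + div(ρu) = ρ G₀(P_M − ρ^γ)` pointwise on `[0,T] × ℝ^d`, then
`∫ ρ(t) ≤ e^{G₀ P_M t} ∫ ρ(0)` for all `t ∈ [0,T]`. -/
theorem stmt0 (d : ℕ) (hd : 1 ≤ d) (T : ℝ) (hT : 0 < T)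
    (γ : ℝ) (hγ : 1 < γ) (G₀ P_M : ℝ) (hG₀ : 0 < G₀) (hPM : 0 < P_M)
    (ρ : ℝ → EuclideanSpace ℝ (Fin d) → ℝ)
    (u : ℝ → EuclideanSpace ℝ (Fin d) → EuclideanSpace ℝ (Fin d))
    (hρC1 : ContDiff ℝ 1 (fun p : ℝ × EuclideanSpace ℝ (Fin d) => ρ p.1 p.2))
    (hρ0 : ∀ t x, 0 ≤ ρ t x)
    (hsupp : ∃ R : ℝ, 0 < R ∧ ∀ t ∈ Set.Icc (0 : ℝ) T,
      ∀ x : EuclideanSpace ℝ (Fin d), R ≤ ‖x‖ → ρ t x = 0)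
    (huC1 : ContDiff ℝ 1 (fun p : ℝ × EuclideanSpace ℝ (Fin d) => u p.1 p.2))
    (hcont : ∀ t ∈ Set.Icc (0 : ℝ) T, ∀ x,
      deriv (fun s => ρ s x) t
        + ∑ i, fderiv ℝ (fun y => ρ t y * u t y i) x (EuclideanSpace.single i 1)
      = ρ t x * (G₀ * (P_M - ρ t x ^ γ))) :
    ∀ t ∈ Set.Icc (0 : ℝ) T,
      (∫ x, ρ t x) ≤ Real.exp (G₀ * P_M * t) * ∫ x, ρ 0 x := by
  obtain ⟨R, hR, hsupp⟩ := hsupp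
  set B : Set (EuclideanSpace ℝ (Fin d)) := Metric.closedBall 0 R
  have hB : IsCompact B := isCompact_closedBall 0 R
  have hout : ∀ t ∈ Set.Icc (0 : ℝ) T, ∀ x ∉ B, ρ t x = 0 := fun t ht x hx =>
    hsupp t ht x (by simpa [B] using (not_le.1 fun h => hx (by simpa [B] using h)).le)
  have hmass : ∀ t ∈ Set.Icc (0 : ℝ) T, ∫ x in B, ρ t x = ∫ x, ρ t x := fun t ht =>
    setIntegral_eq_integral_of_forall_compl_eq_zero (hout t ht)
  have hslice : ∀ t, ContDiff ℝ 1 (ρ t) := fun t =>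
    hρC1.comp (contDiff_const.prodMk contDiff_id)
  have huslice : ∀ t, ContDiff ℝ 1 (u t) := fun t =>
    huC1.comp (contDiff_const.prodMk contDiff_id)
  intro t ht
  rw [← hmass t ht, ← hmass 0 ⟨le_rfl, hT.le⟩]
  refine le_exp_mul_of_hasDerivAt_le (fun t => hasDerivAt_setIntegral_of_contDiff hρC1 hB t)
    (fun t ht => ?_) t ht
  have hflux : ∀ i, ContDiff ℝ 1 fun y => ρ t y * u t y i := fun i =>
    (hslice t).mul (contDiff_euclidean.1 (huslice t) i)
  have hflux_out : ∀ i, ∀ x ∉ B, ρ t x * u t x i = 0 := fun i x hx => by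
    rw [hout t ht x hx, zero_mul]
  have hflux_supp : ∀ i, HasCompactSupport fun y => ρ t y * u t y i := fun i =>
    HasCompactSupport.intro hB (hflux_out i)
  have hdiv_cont : ∀ i, Continuous fun x =>
      fderiv ℝ (fun y => ρ t y * u t y i) x (EuclideanSpace.single i 1) := fun i =>
    ((hflux i).continuous_fderiv one_ne_zero).clm_apply continuous_const
  have hdiv : ∀ i, ∫ x in B,
      fderiv ℝ (fun y => ρ t y * u t y i) x (EuclideanSpace.single i 1) = 0 := fun i => by
    rw [setIntegral_eq_integral_of_forall_compl_eq_zero,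
      integral_fderiv_eq_zero_of_hasCompactSupport (hflux i) (hflux_supp i)]
    intro x hx
    have hz : (fun y => ρ t y * u t y i) =ᶠ[nhds x] fun _ => 0 := by
      filter_upwards [hB.isClosed.isOpen_compl.mem_nhds hx] with y hy using hflux_out i y hy
    simp [hz.fderiv_eq]
  have hdiv_int : ∀ i, IntegrableOn (fun x =>
      fderiv ℝ (fun y => ρ t y * u t y i) x (EuclideanSpace.single i 1)) B := fun i =>
    (hdiv_cont i).continuousOn.integrableOn_compact hB
  have hρ_int : IntegrableOn (ρ t) B := (hslice t).continuous.continuousOn.integrableOn_compact hB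
  have hrhs_int : IntegrableOn (fun x => ρ t x * (G₀ * (P_M - ρ t x ^ γ))) B := by
    refine Continuous.continuousOn ?_ |>.integrableOn_compact hB
    have := (hslice t).continuous
    exact this.mul (continuous_const.mul (continuous_const.sub
      (this.rpow_const fun _ => Or.inr (by linarith))))
  calc ∫ x in B, deriv (fun s => ρ s x) t
      = ∫ x in B, (ρ t x * (G₀ * (P_M - ρ t x ^ γ))
          - ∑ i, fderiv ℝ (fun y => ρ t y * u t y i) x (EuclideanSpace.single i 1)) := by
        simp only [← hcont t ht, add_sub_cancel_right]
    _ = ∫ x in B, ρ t x * (G₀ * (P_M - ρ t x ^ γ)) := by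
        rw [integral_sub hrhs_int (integrable_finsetSum _ fun i _ => hdiv_int i),
          integral_finsetSum _ fun i _ => hdiv_int i]
        simp [hdiv]
    _ ≤ ∫ x in B, G₀ * P_M * ρ t x := by
        refine integral_mono hrhs_int (hρ_int.const_mul _) fun x => ?_
        have h1 := hρ0 t x
        have h2 := mul_nonneg (mul_nonneg h1 hG₀.le) (rpow_nonneg h1 γ)
        simp only
        linarith
    _ = G₀ * P_M * ∫ x in B, ρ t x := integral_const_mul _ _
end

section
/- Let (Ω, μ) be a measure space, C > 0, M ≥ 0, and let (γₙ) be a sequence of real numbers with γₙ > 1 for all n and γₙ → ∞. Let (ρₙ) be a sequence of nonnegative measurable functions on Ω such that ‖ρₙ‖_{L¹(μ)} ≤ M and ‖ρₙ‖_{L^{γₙ}(μ)} ≤ (C·γₙ)^{1/γₙ} for every n. Then for every q ∈ (1, ∞), limsup_{n→∞} ‖ρₙ‖_{L^q(μ)} ≤ M^{1/q}. -/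
open MeasureTheory Filter Real

open scoped Topology

/-- Lebesgue interpolation between `L¹` and `Lʳ`, in terms of powers of the norms. -/
theorem eLpNorm_rpow_le_eLpNorm_one_rpow_mul {α E : Type*} [MeasurableSpace α]
    [NormedAddCommGroup E] {μ : Measure α} {f : α → E} (hf : AEStronglyMeasurable f μ)
    {q r : ℝ} (hq : 1 ≤ q) (hqr : q ≤ r) (hr : 1 < r) :
    eLpNorm f (ENNReal.ofReal q) μ ^ q ≤
      eLpNorm f 1 μ ^ ((r - q) / (r - 1)) *
        (eLpNorm f (ENNReal.ofReal r) μ ^ r) ^ ((q - 1) / (r - 1)) := by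
  have hq0 : 0 < q := by linarith
  have hr0 : 0 < r := by linarith
  have hr1 : 0 < r - 1 := by linarith
  have eLpNorm_rpow {p : ℝ} (hp : 0 < p) :
      eLpNorm f (ENNReal.ofReal p) μ ^ p = ∫⁻ x, ‖f x‖ₑ ^ p ∂μ := by
    rw [eLpNorm_eq_lintegral_rpow_enorm_toReal (by simpa using hp) ENNReal.ofReal_ne_top,
      ENNReal.toReal_ofReal hp.le, ← ENNReal.rpow_mul, one_div_mul_cancel hp.ne',
      ENNReal.rpow_one]
  have hs : 0 ≤ (r - q) / (r - 1) := div_nonneg (by linarith) hr1.le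
  have ht : 0 ≤ (q - 1) / (r - 1) := div_nonneg (by linarith) hr1.le
  rw [eLpNorm_rpow hq0, eLpNorm_rpow hr0, eLpNorm_one_eq_lintegral_enorm]
  refine le_of_eq_of_le (lintegral_congr fun x => ?_)
    (ENNReal.lintegral_mul_norm_pow_le hf.enorm (hf.enorm.pow_const r) hs ht
      (by field_simp; ring))
  rw [← ENNReal.rpow_mul, ← ENNReal.rpow_add_of_nonneg _ _ hs (mul_nonneg hr0.le ht)]
  congr 1
  field_simp
  ring

/-- Interpolation bound: if `‖ρₙ‖_{L¹} ≤ M` and `‖ρₙ‖_{L^{γₙ}} ≤ (Cγₙ)^{1/γₙ}` with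
`γₙ → ∞`, then for every `q ∈ (1,∞)`, `limsup ‖ρₙ‖_{L^q} ≤ M^{1/q}`. -/
theorem stmt3 {Ω : Type*} [MeasurableSpace Ω] (μ : Measure Ω)
    (C M : ℝ) (hC : 0 < C) (hM : 0 ≤ M)
    (γ : ℕ → ℝ) (hγ : ∀ n, 1 < γ n) (hγtop : Tendsto γ atTop atTop)
    (ρ : ℕ → Ω → ℝ) (hmeas : ∀ n, Measurable (ρ n)) (hpos : ∀ n x, 0 ≤ ρ n x)
    (hL1 : ∀ n, eLpNorm (ρ n) 1 μ ≤ ENNReal.ofReal M)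
    (hLγ : ∀ n, eLpNorm (ρ n) (ENNReal.ofReal (γ n)) μ
      ≤ ENNReal.ofReal ((C * γ n) ^ (1 / γ n)))
    (q : ℝ) (hq : 1 < q) :
    limsup (fun n => eLpNorm (ρ n) (ENNReal.ofReal q) μ) atTop
      ≤ ENNReal.ofReal (M ^ (1 / q)) := by
  have hq0 : 0 < q := by linarith
  have hs : Tendsto (fun n => (γ n - q) / (γ n - 1)) atTop (𝓝 1) := by
    have h : Tendsto (fun n => 1 - (q - 1) / (γ n - 1)) atTop (𝓝 (1 - 0)) :=
      tendsto_const_nhds.sub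
        (tendsto_const_nhds.div_atTop (tendsto_atTop_add_const_right _ (-1) hγtop))
    rw [sub_zero] at h
    refine h.congr fun n => ?_
    have : γ n - 1 ≠ 0 := by linarith [hγ n]
    field_simp
    ring
  have ht : Tendsto (fun n => (C * γ n) ^ ((q - 1) / (γ n - 1))) atTop (𝓝 1) := by
    refine ((tendsto_rpow_div_mul_add (q - 1) C⁻¹ (-1) (inv_pos.2 hC).ne).comp
      (hγtop.const_mul_atTop hC)).congr fun n => ?_
    simp only [Function.comp_apply, inv_mul_cancel_left₀ hC.ne', ← sub_eq_add_neg]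
  have hlim : Tendsto (fun n => ENNReal.ofReal
      ((M ^ ((γ n - q) / (γ n - 1)) * (C * γ n) ^ ((q - 1) / (γ n - 1))) ^ (1 / q)))
      atTop (𝓝 (ENNReal.ofReal (M ^ (1 / q)))) := by
    refine ENNReal.tendsto_ofReal (Tendsto.rpow_const ?_ (Or.inr (by positivity)))
    simpa using (tendsto_const_nhds.rpow hs (Or.inr one_pos)).mul ht
  rw [← hlim.limsup_eq]
  refine limsup_le_limsup ?_
  filter_upwards [hγtop.eventually_ge_atTop q] with n hn
  have hγ1 : 0 < γ n - 1 := by linarith [hγ n]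
  have hCγ : 0 < C * γ n := mul_pos hC (by linarith)
  have hs0 : 0 ≤ (γ n - q) / (γ n - 1) := div_nonneg (by linarith) hγ1.le
  have ht0 : 0 ≤ (q - 1) / (γ n - 1) := div_nonneg (by linarith) hγ1.le
  have hγn : eLpNorm (ρ n) (ENNReal.ofReal (γ n)) μ ^ γ n ≤ ENNReal.ofReal (C * γ n) := by
    refine (ENNReal.rpow_le_rpow (hLγ n) (by linarith)).trans_eq ?_
    rw [ENNReal.ofReal_rpow_of_nonneg (by positivity) (by linarith),
      ← Real.rpow_mul hCγ.le, one_div_mul_cancel (by linarith), Real.rpow_one]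
  rw [← ENNReal.ofReal_rpow_of_nonneg (by positivity) (by positivity), one_div,
    ENNReal.le_rpow_inv_iff hq0, ENNReal.ofReal_mul (by positivity),
    ← ENNReal.ofReal_rpow_of_nonneg hM hs0, ← ENNReal.ofReal_rpow_of_nonneg hCγ.le ht0]
  refine (eLpNorm_rpow_le_eLpNorm_one_rpow_mul (hmeas n).aestronglyMeasurable hq.le hn
    (hγ n)).trans ?_
  gcongr
  exact hL1 n
end

section
/- For every real number q > 1 there exist a constant a_q > 0 and a threshold k₀ ≥ 1 such that for every real k ≥ k₀ and every real x ≥ 0, (1+x)^k ≥ 1 + a_q · k^q · x^q. -/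
open Real

/-- For every `q > 1` there exist `a_q > 0` and `k₀ ≥ 1` such that for every `k ≥ k₀`
and every `x ≥ 0`, `(1+x)^k ≥ 1 + a_q k^q x^q` (real powers). -/
theorem stmt5 (q : ℝ) (hq : 1 < q) :
    ∃ a : ℝ, 0 < a ∧ ∃ k₀ : ℝ, 1 ≤ k₀ ∧
      ∀ k : ℝ, k₀ ≤ k → ∀ x : ℝ, 0 ≤ x →
        (1 + x) ^ k ≥ 1 + a * k ^ q * x ^ q := by
  have hq0 : 0 < q := by linarith
  refine ⟨q⁻¹ ^ q, by positivity, q, hq.le, fun k hk x hx => ?_⟩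
  have hk0 : 0 < k := hq0.trans_le hk
  have hy : 0 ≤ q⁻¹ * k * x := by positivity
  calc 1 + q⁻¹ ^ q * k ^ q * x ^ q = 1 ^ q + (q⁻¹ * k * x) ^ q := by
        rw [mul_rpow (by positivity) hx, mul_rpow (by positivity) hk0.le, one_rpow]
    _ ≤ (1 + q⁻¹ * k * x) ^ q := by
        exact_mod_cast NNReal.add_rpow_le_rpow_add 1 ⟨q⁻¹ * k * x, hy⟩ hq.le
    _ ≤ ((1 + x) ^ (q⁻¹ * k)) ^ q := by
        gcongr
        refine one_add_mul_self_le_rpow_one_add (by linarith) ?_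
        rwa [inv_mul_eq_div, one_le_div hq0]
    _ = (1 + x) ^ k := by
        rw [← rpow_mul (by positivity)]
        congr 1
        field_simp
end

section
/- Let (Ω, μ) be a measure space, C > 0, and let (γₙ) be a sequence of real numbers with γₙ > 1 for all n and γₙ → ∞. Let (ρₙ) be a sequence of nonnegative measurable functions on Ω such that ∫_Ω ρₙ^{γₙ} dμ ≤ C·γₙ for every n. Then for every real q ∈ (1, ∞), ∫_Ω (max(ρₙ − 1, 0))^q dμ → 0 as n → ∞; in particular (ρₙ − 1)₊ → 0 strongly in L^q(μ). -/
open MeasureTheory Filter Real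

/-- A consequence of Bernoulli's inequality: the `q`-th power of `(t - 1)₊` is controlled by
`t ^ p` with the constant `(q / p) ^ q`. -/
theorem max_sub_one_rpow_le {t p q : ℝ} (ht : 0 ≤ t) (hq : 0 < q) (hqp : q ≤ p) :
    max (t - 1) 0 ^ q ≤ (q / p) ^ q * t ^ p := by
  have hp : 0 < p := hq.trans_le hqp
  rcases le_total t 1 with h | h
  · rw [max_eq_right (by linarith), zero_rpow hq.ne']
    positivity
  · rw [max_eq_left (by linarith)]
    have bernoulli : 1 + p / q * (t - 1) ≤ t ^ (p / q) := by
      have := one_add_mul_self_le_rpow_one_add (s := t - 1) (by linarith)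
        ((one_le_div hq).2 hqp)
      rwa [add_sub_cancel] at this
    have linear : t - 1 ≤ q / p * t ^ (p / q) := by
      calc t - 1 = q / p * (p / q * (t - 1)) := by field_simp
        _ ≤ q / p * t ^ (p / q) := by gcongr; linarith
    calc (t - 1) ^ q ≤ (q / p * t ^ (p / q)) ^ q :=
          rpow_le_rpow (by linarith) linear hq.le
      _ = (q / p) ^ q * t ^ p := by
          rw [mul_rpow (by positivity) (by positivity), ← rpow_mul ht, div_mul_cancel₀ _ hq.ne']

/-- If `∫ ρₙ^{γₙ} dμ ≤ C γₙ` with `γₙ → ∞`, then for every `q ∈ (1,∞)`,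
`∫ ((ρₙ − 1)₊)^q dμ → 0`, i.e. `(ρₙ − 1)₊ → 0` strongly in `L^q(μ)`. -/
theorem stmt6 {Ω : Type*} [MeasurableSpace Ω] (μ : Measure Ω) (C : ℝ) (hC : 0 < C)
    (γ : ℕ → ℝ) (hγ : ∀ n, 1 < γ n) (hγtop : Tendsto γ atTop atTop)
    (ρ : ℕ → Ω → ℝ) (hmeas : ∀ n, Measurable (ρ n)) (hpos : ∀ n x, 0 ≤ ρ n x)
    (hint : ∀ n, ∫⁻ x, ENNReal.ofReal (ρ n x ^ γ n) ∂μ ≤ ENNReal.ofReal (C * γ n))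
    (q : ℝ) (hq : 1 < q) :
    Tendsto (fun n => ∫⁻ x, ENNReal.ofReal (max (ρ n x - 1) 0 ^ q) ∂μ)
      atTop (nhds 0) := by
  have hq0 : 0 < q := by linarith
  have bound_tendsto : Tendsto (fun n => ENNReal.ofReal (C * q ^ q * γ n ^ (-(q - 1))))
      atTop (nhds 0) := by
    have := (((tendsto_rpow_neg_atTop (sub_pos.2 hq)).comp hγtop).const_mul (C * q ^ q))
    simpa using ENNReal.tendsto_ofReal this
  refine tendsto_of_tendsto_of_tendsto_of_le_of_le' tendsto_const_nhds bound_tendsto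
    (Eventually.of_forall fun _ => zero_le) ?_
  filter_upwards [hγtop.eventually_ge_atTop q] with n hn
  have hγ0 : 0 < γ n := hq0.trans_le hn
  have hc : 0 ≤ (q / γ n) ^ q := by positivity
  calc ∫⁻ x, ENNReal.ofReal (max (ρ n x - 1) 0 ^ q) ∂μ
      ≤ ∫⁻ x, ENNReal.ofReal ((q / γ n) ^ q) * ENNReal.ofReal (ρ n x ^ γ n) ∂μ := by
        refine lintegral_mono fun x => ?_
        rw [← ENNReal.ofReal_mul hc]
        exact ENNReal.ofReal_le_ofReal (max_sub_one_rpow_le (hpos n x) hq0 hn)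
    _ = ENNReal.ofReal ((q / γ n) ^ q) * ∫⁻ x, ENNReal.ofReal (ρ n x ^ γ n) ∂μ :=
        lintegral_const_mul' _ _ ENNReal.ofReal_ne_top
    _ ≤ ENNReal.ofReal ((q / γ n) ^ q) * ENNReal.ofReal (C * γ n) := by
        gcongr
        exact hint n
    _ = ENNReal.ofReal (C * q ^ q * γ n ^ (-(q - 1))) := by
        rw [← ENNReal.ofReal_mul hc, div_rpow hq0.le hγ0.le, neg_sub, rpow_sub hγ0, rpow_one]
        congr 1
        ring
end

section
/- Let d ≥ 1 be an integer, T > 0, and G₀, P_M > 0. Let ρ : [0,T] × ℝ^d → ℝ be C¹ and nonnegative, with ρ(t,x) = 0 whenever |x| ≥ R (for some R > 0 and all t ∈ [0,T]); let u : [0,T] × ℝ^d → ℝ^d be C¹; and let g : [0,T] × ℝ^d → ℝ be continuous with g(t,x) ≤ G₀·P_M for all (t,x). Assume the transport equation with growth ∂ₜρ + div(ρu) = ρ·g holds pointwise on [0,T] × ℝ^d. Then the following two assertions are equivalent: (i) div u(t,x) = g(t,x) for almost every (t,x) in the set {(t,x) : ρ(t,x) ≥ 1}, and ρ(0,x) ≤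 1 for all x ∈ ℝ^d; (ii) ρ(t,x) ≤ 1 for all (t,x) ∈ [0,T] × ℝ^d. -/
open MeasureTheory Real

/-- The spatial divergence of a jointly `C¹` time-dependent vector field is jointly continuous. -/
lemma continuous_sum_fderiv_single {d : ℕ}
    {u : ℝ → EuclideanSpace ℝ (Fin d) → EuclideanSpace ℝ (Fin d)}
    (hu : ContDiff ℝ 1 (fun p : ℝ × EuclideanSpace ℝ (Fin d) => u p.1 p.2)) :
    Continuous (fun z : ℝ × EuclideanSpace ℝ (Fin d) =>
      ∑ i, fderiv ℝ (fun y => u z.1 y i) z.2 (EuclideanSpace.single i 1)) := by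
  refine continuous_finsetSum _ fun i _ => ?_
  have hui : ContDiff ℝ 1 (fun p : ℝ × EuclideanSpace ℝ (Fin d) => u p.1 p.2 i) :=
    contDiff_euclidean.1 hu i
  have hunc : ContDiff ℝ 1 (Function.uncurry
      fun (z : ℝ × EuclideanSpace ℝ (Fin d)) (y : EuclideanSpace ℝ (Fin d)) => u z.1 y i) :=
    hui.comp ((contDiff_fst.comp contDiff_fst).prodMk contDiff_snd)
  have h : ContDiff ℝ 0 (fun z : ℝ × EuclideanSpace ℝ (Fin d) =>
      fderiv ℝ (fun y => u z.1 y i) z.2) :=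
    ContDiff.fderiv hunc contDiff_snd (by simp)
  exact h.continuous.clm_apply continuous_const

/-- At a critical point of `r`, the divergence of `r • v` is `r` times the divergence of `v`. -/
lemma sum_fderiv_mul_single_of_fderiv_eq_zero {d : ℕ} {r : EuclideanSpace ℝ (Fin d) → ℝ}
    {v : EuclideanSpace ℝ (Fin d) → EuclideanSpace ℝ (Fin d)} {x : EuclideanSpace ℝ (Fin d)}
    (hr : DifferentiableAt ℝ r x) (hv : DifferentiableAt ℝ v x) (h0 : fderiv ℝ r x = 0) :
    ∑ i, fderiv ℝ (fun y => r y * v y i) x (EuclideanSpace.single i 1)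
      = r x * ∑ i, fderiv ℝ (fun y => v y i) x (EuclideanSpace.single i 1) := by
  rw [Finset.mul_sum]
  refine Finset.sum_congr rfl fun i _ => ?_
  rw [fderiv_fun_mul hr (differentiableAt_euclidean.1 hv i), h0]
  simp

/-- A function that is maximal over `[0, T]` at a positive time has nonnegative derivative there. -/
lemma HasDerivAt.nonneg_of_isMaxOn_Icc {f : ℝ → ℝ} {f' t T : ℝ} (hf : HasDerivAt f f' t)
    (ht : 0 < t) (htT : t ≤ T) (hmax : IsMaxOn f (Set.Icc 0 T) t) : 0 ≤ f' := by
  have hseg : segment ℝ t 0 ⊆ Set.Icc 0 T :=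
    (convex_Icc 0 T).segment_subset ⟨ht.le, htT⟩ ⟨le_rfl, ht.le.trans htT⟩
  have h := hmax.localize.hasFDerivWithinAt_nonpos hf.hasFDerivAt.hasFDerivWithinAt
    (sub_mem_posTangentConeAt_of_segment_subset hseg)
  simp at h
  exact nonneg_of_mul_nonneg_right h ht

/-- Two continuous functions that agree almost everywhere on the part of the slab `[0, T] × E`
where `r > 1` agree everywhere there. -/
lemma eq_of_ae_eq_on_slab {d : ℕ} {T : ℝ} (hT : 0 < T)
    {r a b : ℝ × EuclideanSpace ℝ (Fin d) → ℝ}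
    (hr : Continuous r) (ha : Continuous a) (hb : Continuous b)
    (hae : ∀ᵐ z ∂(volume : Measure (ℝ × EuclideanSpace ℝ (Fin d))),
      (z.1 ∈ Set.Icc (0 : ℝ) T ∧ 1 ≤ r z) → a z = b z)
    {z : ℝ × EuclideanSpace ℝ (Fin d)} (hz : z.1 ∈ Set.Icc (0 : ℝ) T) (hrz : 1 < r z) :
    a z = b z := by
  have hV : IsOpen {z | 1 < r z} := isOpen_lt continuous_const hr
  have hs : MeasurableSet ({z | 1 < r z} ∩ Set.Icc (0 : ℝ) T ×ˢ Set.univ) :=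
    hV.measurableSet.inter (measurableSet_Icc.prod MeasurableSet.univ)
  refine Measure.eqOn_of_ae_eq (μ := volume)
    (s := {z | 1 < r z} ∩ Set.Icc (0 : ℝ) T ×ˢ Set.univ) ?_ ha.continuousOn hb.continuousOn ?_
    ⟨hrz, hz, trivial⟩
  · rw [Filter.EventuallyEq, ae_restrict_iff' hs]
    filter_upwards [hae] with w hw hws
    exact hw ⟨hws.2.1, hws.1.le⟩
  · rw [interior_inter, hV.interior_eq, interior_prod_eq, interior_Icc, interior_univ]
    refine subset_trans ?_ hV.inter_closure
    rw [closure_prod_eq, closure_Ioo hT.ne, closure_univ]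

/-- Consistency relation (classical-solution version of Lemma 5.2): for a nonnegative `C¹`
density `ρ` compactly supported in space, a `C¹` velocity `u`, and a continuous growth rate
`g ≤ G₀P_M`, satisfying `∂ₜρ + div(ρu) = ρg` pointwise on `[0,T] × ℝ^d`, the following are
equivalent: (i) `div u = g` a.e. on `{(t,x) ∈ [0,T] × ℝ^d : ρ ≥ 1}` and `ρ(0,·) ≤ 1`;
(ii) `ρ ≤ 1` on all of `[0,T] × ℝ^d`. -/
theorem stmt17 (d : ℕ) (hd : 1 ≤ d) (T : ℝ) (hT : 0 < T)
    (G₀ P_M : ℝ) (hG₀ : 0 < G₀) (hPM : 0 < P_M)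
    (ρ : ℝ → EuclideanSpace ℝ (Fin d) → ℝ)
    (u : ℝ → EuclideanSpace ℝ (Fin d) → EuclideanSpace ℝ (Fin d))
    (g : ℝ → EuclideanSpace ℝ (Fin d) → ℝ)
    (hρC1 : ContDiff ℝ 1 (fun p : ℝ × EuclideanSpace ℝ (Fin d) => ρ p.1 p.2))
    (hρ0 : ∀ t x, 0 ≤ ρ t x)
    (hsupp : ∃ R : ℝ, 0 < R ∧ ∀ t ∈ Set.Icc (0 : ℝ) T,
      ∀ x : EuclideanSpace ℝ (Fin d), R ≤ ‖x‖ → ρ t x = 0)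
    (huC1 : ContDiff ℝ 1 (fun p : ℝ × EuclideanSpace ℝ (Fin d) => u p.1 p.2))
    (hgcont : Continuous (fun p : ℝ × EuclideanSpace ℝ (Fin d) => g p.1 p.2))
    (hgle : ∀ t x, g t x ≤ G₀ * P_M)
    (heq : ∀ t ∈ Set.Icc (0 : ℝ) T, ∀ x,
      deriv (fun s => ρ s x) t
        + ∑ i, fderiv ℝ (fun y => ρ t y * u t y i) x (EuclideanSpace.single i 1)
      = ρ t x * g t x) :
    ((∀ᵐ z ∂(volume : Measure (ℝ × EuclideanSpace ℝ (Fin d))),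
        (z.1 ∈ Set.Icc (0 : ℝ) T ∧ 1 ≤ ρ z.1 z.2) →
          (∑ i, fderiv ℝ (fun y => u z.1 y i) z.2 (EuclideanSpace.single i 1))
            = g z.1 z.2)
      ∧ (∀ x, ρ 0 x ≤ 1))
    ↔ (∀ t ∈ Set.Icc (0 : ℝ) T, ∀ x, ρ t x ≤ 1) := by
  have hρx : ∀ t x, DifferentiableAt ℝ (ρ t) x := fun t x =>
    (hρC1.differentiable one_ne_zero).comp (differentiable_const t |>.prodMk differentiable_id) x
  have hρt : ∀ t x, DifferentiableAt ℝ (fun s => ρ s x) t := fun t x =>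
    (hρC1.differentiable one_ne_zero).comp (differentiable_id.prodMk (differentiable_const x)) t
  have hux : ∀ t x, DifferentiableAt ℝ (u t) x := fun t x =>
    (huC1.differentiable one_ne_zero).comp (differentiable_const t |>.prodMk differentiable_id) x
  have hcrit : ∀ t ∈ Set.Icc (0 : ℝ) T, ∀ x, fderiv ℝ (ρ t) x = 0 →
      deriv (fun s => ρ s x) t
        + ρ t x * ∑ i, fderiv ℝ (fun y => u t y i) x (EuclideanSpace.single i 1)
        = ρ t x * g t x := fun t ht x h0 => by
    rw [← sum_fderiv_mul_single_of_fderiv_eq_zero (hρx t x) (hux t x) h0]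
    exact heq t ht x
  constructor
  · rintro ⟨hae, hinit⟩ t₀ ht₀ x₀
    by_contra! hgt
    obtain ⟨R, -, hR⟩ := hsupp
    obtain ⟨ε, hε, hεT⟩ : ∃ ε : ℝ, 0 < ε ∧ ε * T < ρ t₀ x₀ - 1 :=
      ⟨(ρ t₀ x₀ - 1) / (2 * T), by have := sub_pos.2 hgt; positivity, by field_simp; linarith⟩
    have hout : ∀ t ∈ Set.Icc (0 : ℝ) T, ∀ x, x ∉ Metric.closedBall 0 R → ρ t x = 0 :=
      fun t ht x hx => hR t ht x (by simpa using (not_le.1 (by simpa using hx)).le)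
    have hx₀ : x₀ ∈ Metric.closedBall 0 R := by
      by_contra hx
      linarith [hout t₀ ht₀ x₀ hx]
    have hcont : Continuous fun p : ℝ × EuclideanSpace ℝ (Fin d) => ρ p.1 p.2 - ε * p.1 :=
      hρC1.continuous.sub (continuous_const.mul continuous_fst)
    obtain ⟨⟨t₁, x₁⟩, ⟨ht₁, -⟩, hmax⟩ :=
      (isCompact_Icc.prod (isCompact_closedBall (0 : EuclideanSpace ℝ (Fin d)) R)).exists_isMaxOn
        ⟨(t₀, x₀), ht₀, hx₀⟩ hcont.continuousOn
    replace hmax : ∀ t ∈ Set.Icc (0 : ℝ) T, ∀ x ∈ Metric.closedBall 0 R,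
        ρ t x - ε * t ≤ ρ t₁ x₁ - ε * t₁ := fun t ht x hx =>
      isMaxOn_iff.1 hmax (t, x) (Set.mk_mem_prod ht hx)
    have hle : 1 < ρ t₁ x₁ - ε * t₁ := by
      have h : ρ t₀ x₀ - ε * t₀ ≤ ρ t₁ x₁ - ε * t₁ := hmax t₀ ht₀ x₀ hx₀
      have := mul_le_mul_of_nonneg_left ht₀.2 hε.le
      linarith
    have hglob : ∀ t ∈ Set.Icc (0 : ℝ) T, ∀ x, ρ t x - ε * t ≤ ρ t₁ x₁ - ε * t₁ := by
      intro t ht x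
      by_cases hx : x ∈ Metric.closedBall 0 R
      · exact hmax t ht x hx
      · rw [hout t ht x hx]
        have := mul_nonneg hε.le ht.1
        linarith
    have hgt₁ : 1 < ρ t₁ x₁ := by
      have := mul_nonneg hε.le ht₁.1
      linarith
    have hpos : 0 < t₁ := by
      refine lt_of_le_of_ne ht₁.1 ?_
      rintro rfl
      linarith [hinit x₁]
    have hgrad : fderiv ℝ (ρ t₁) x₁ = 0 :=
      IsLocalMax.fderiv_eq_zero (Filter.Eventually.of_forall fun x => by
        linarith [hglob t₁ ht₁ x])
    have hdiv := eq_of_ae_eq_on_slab hT hρC1.continuous (continuous_sum_fderiv_single huC1)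
      hgcont hae (z := (t₁, x₁)) ht₁ hgt₁
    have hder : deriv (fun s => ρ s x₁) t₁ = 0 := by
      have h := hcrit t₁ ht₁ x₁ hgrad
      simp only at hdiv
      rw [hdiv] at h
      linarith
    have hφ : HasDerivAt (fun s => ρ s x₁ - ε * s) (0 - ε * 1) t₁ :=
      (hder ▸ (hρt t₁ x₁).hasDerivAt).sub ((hasDerivAt_id t₁).const_mul ε)
    have := hφ.nonneg_of_isMaxOn_Icc hpos ht₁.2 fun s hs => hglob s hs x₁
    linarith
  · intro hle
    refine ⟨?_, hle 0 ⟨le_rfl, hT.le⟩⟩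
    have hends : ∀ c : ℝ, ∀ᵐ z ∂(volume : Measure (ℝ × EuclideanSpace ℝ (Fin d))), z.1 ≠ c :=
      fun c => Measure.quasiMeasurePreserving_fst.ae (Measure.ae_ne volume c)
    filter_upwards [hends 0, hends T] with z h0 hTz
    rintro ⟨hz, hρz⟩
    have h1 : ρ z.1 z.2 = 1 := le_antisymm (hle _ hz _) hρz
    have hgrad : fderiv ℝ (ρ z.1) z.2 = 0 :=
      IsLocalMax.fderiv_eq_zero (Filter.Eventually.of_forall fun x => by
        simpa only [h1] using hle z.1 hz x)
    have hder : deriv (fun s => ρ s z.2) z.1 = 0 := by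
      refine IsLocalMax.deriv_eq_zero ?_
      filter_upwards [Icc_mem_nhds (lt_of_le_of_ne hz.1 h0.symm) (lt_of_le_of_ne hz.2 hTz)]
        with s hs
      simpa only [h1] using hle s hs z.2
    simpa [hder, h1] using hcrit z.1 hz z.2 hgrad
end
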